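/- The number of pairs (σ•, σ∘) of permutations of the set {1,…,6}, where σ• is a product of two disjoint 3-cycles, σ∘ is a fixed-point-free involution, and the subgroup generated by σ• and σ∘ acts transitively, counted up to simultaneous conjugation by arbitrary permutations of {1,…,6}, equals 3. -/

import Mathlib

open Equiv

/-- Regular trivalent diagrams of size 6: σ• a product of two disjoint 3-cycles,
σ∘ a fixed-point-free involution (three 2-cycles), ⟨σ•, σ∘⟩ transitive. -/
def Diag6 : Type :=
  {p : Equiv.Perm (Fin 6) × Equiv.Perm (Fin 6) //
    p.1.cycleType = {3, 3} ∧ p.2.cycleType = {2, 2, 2} ∧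
    ∀ a b : Fin 6, ∃ g ∈ Subgroup.closure {p.1, p.2}, g a = b}

/-- Isomorphism of (unrooted) diagrams: simultaneous conjugation by an arbitrary
permutation of {1,…,6}. -/
def diagIso : Setoid Diag6 where
  r p q := ∃ ρ : Equiv.Perm (Fin 6),
    ρ * p.1.1 * ρ⁻¹ = q.1.1 ∧ ρ * p.1.2 * ρ⁻¹ = q.1.2
  iseqv := by
    refine ⟨fun p => ⟨1, by group, by group⟩, ?_, ?_⟩
    · rintro p q ⟨ρ, h1, h2⟩
      exact ⟨ρ⁻¹, by rw [← h1]; group, by rw [← h2]; group⟩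
    · rintro p q r ⟨ρ, h1, h2⟩ ⟨τ, k1, k2⟩
      exact ⟨τ * ρ, by rw [← k1, ← h1]; group, by rw [← k2, ← h2]; group⟩

namespace Diag6Aux

/-- the first 3-cycle -/
def c : Perm (Fin 6) := swap 0 1 * swap 1 2
/-- the second 3-cycle -/
def d : Perm (Fin 6) := swap 3 4 * swap 4 5
/-- the exchange of the two 3-cycles -/
def w : Perm (Fin 6) := swap 0 3 * swap 1 4 * swap 2 5
/-- reference product of two 3-cycles -/
def s : Perm (Fin 6) := c * d
/-- the three representatives of the involution -/
def t : Fin 3 → Perm (Fin 6) :=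
  ![swap 0 3 * swap 1 4 * swap 2 5, swap 0 3 * swap 1 5 * swap 2 4,
    swap 0 3 * swap 1 2 * swap 4 5]
/-- elements of the centralizer of `s` -/
def z (i j : Fin 3) (k : Fin 2) : Perm (Fin 6) := w ^ k.1 * (c ^ i.1 * d ^ j.1)

theorem z_comm : ∀ i j k, z i j k * s = s * z i j k := by decide +kernel

theorem s_type : s.cycleType = {3, 3} := by decide +kernel

theorem t_type : ∀ i, (t i).cycleType = {2, 2, 2} := by decide +kernel

theorem t_words : ∀ (i : Fin 3) (a b : Fin 6), ∃ (k l : Fin 3) (j : Fin 2),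
    (s ^ k.1 * (t i ^ j.1 * s ^ l.1)) a = b := by decide +kernel

theorem t_trans (i : Fin 3) (a b : Fin 6) :
    ∃ g ∈ Subgroup.closure {s, t i}, g a = b := by
  obtain ⟨k, l, j, h⟩ := t_words i a b
  have hs : s ∈ Subgroup.closure {s, t i} := Subgroup.subset_closure (by simp)
  have ht : t i ∈ Subgroup.closure {s, t i} := Subgroup.subset_closure (by simp)
  exact ⟨_, mul_mem (pow_mem hs _) (mul_mem (pow_mem ht _) (pow_mem hs _)), h⟩

/-- representatives -/
def rep (i : Fin 3) : Diag6 := ⟨(s, t i), s_type, t_type i, t_trans i⟩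

set_option synthInstance.maxHeartbeats 400000 in
set_option synthInstance.maxSize 4000 in
theorem enum : ∀ a : Fin 6, a ≠ 0 → ∀ b : Fin 6, b ≠ 1 → (a = 1 ↔ b = 0) →
    ∀ e : Fin 6, e ≠ 2 → (a = 2 ↔ e = 0) → (b = 2 ↔ e = 1) → a ≠ b → a ≠ e → b ≠ e →
    ¬ (a < 3 ∧ b < 3 ∧ e < 3) →
    ∀ f : Fin 6, f ≠ 3 → (a = 3 ↔ f = 0) → (b = 3 ↔ f = 1) → (e = 3 ↔ f = 2) →
    ∀ g : Fin 6, g ≠ 4 → (a = 4 ↔ g = 0) → (b = 4 ↔ g = 1) → (e = 4 ↔ g = 2) →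
      (f = 4 ↔ g = 3) →
    ∀ h : Fin 6, h ≠ 5 → (a = 5 ↔ h = 0) → (b = 5 ↔ h = 1) → (e = 5 ↔ h = 2) →
      (f = 5 ↔ h = 3) → (g = 5 ↔ h = 4) →
    ∃ (m i j : Fin 3) (k : Fin 2), ∀ x : Fin 6, z i j k (![a, b, e, f, g, h] x) = t m (z i j k x) := by
  decide +kernel

theorem enum_perm (u : Perm (Fin 6)) (h2 : ∀ x, u (u x) = x) (hf : ∀ x, u x ≠ x)
    (h3 : ¬ (u 0 < 3 ∧ u 1 < 3 ∧ u 2 < 3)) :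
    ∃ m i j k, z i j k * u * (z i j k)⁻¹ = t m := by
  have key : ∀ x y, u x = y ↔ u y = x := fun x y =>
    ⟨fun h => by rw [← h, h2], fun h => by rw [← h, h2]⟩
  have inj : ∀ x y, x ≠ y → u x ≠ u y := fun x y h h' => h (u.injective h')
  obtain ⟨m, i, j, k, h⟩ := enum (u 0) (hf 0) (u 1) (hf 1) (key _ _) (u 2) (hf 2) (key _ _)
    (key _ _) (inj _ _ (by decide)) (inj _ _ (by decide)) (inj _ _ (by decide)) h3
    (u 3) (hf 3) (key _ _) (key _ _) (key _ _)
    (u 4) (hf 4) (key _ _) (key _ _) (key _ _) (key _ _)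
    (u 5) (hf 5) (key _ _) (key _ _) (key _ _) (key _ _) (key _ _)
  refine ⟨m, i, j, k, ?_⟩
  rw [mul_inv_eq_iff_eq_mul]
  ext x : 1
  have hx : ![u 0, u 1, u 2, u 3, u 4, u 5] x = u x := by fin_cases x <;> rfl
  have := h x
  rw [hx] at this
  exact this

theorem stab (u : Perm (Fin 6)) (hu : ∀ x : Fin 6, x < 3 ↔ u x < 3)
    (g : Perm (Fin 6)) (hg : g ∈ Subgroup.closure {s, u}) : ∀ x : Fin 6, x < 3 ↔ g x < 3 := by
  induction hg using Subgroup.closure_induction with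
  | mem y hy =>
    rcases hy with rfl | rfl
    · decide +kernel
    · exact hu
  | one => simp
  | mul a b _ _ ha hb => intro x; rw [hb x, ha (b x)]; rfl
  | inv a _ ha => intro x; rw [ha (a⁻¹ x)]; simp

theorem normal (u : Perm (Fin 6)) (hc : u.cycleType = {2, 2, 2})
    (htr : ∃ g ∈ Subgroup.closure {s, u}, g 0 = 3) :
    ∃ m i j k, z i j k * u * (z i j k)⁻¹ = t m := by
  have ho : u ^ 2 = 1 := by
    have : orderOf u = 2 := by rw [← Perm.lcm_cycleType, hc]; decide
    rw [← this]; exact pow_orderOf_eq_one u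
  have h2 : ∀ x, u (u x) = x := fun x => by
    have := congrArg (fun g : Perm (Fin 6) => g x) ho
    simpa [pow_two] using this
  have hs : u.support = Finset.univ := by
    apply Finset.eq_univ_of_card
    rw [← Perm.sum_cycleType, hc]; rfl
  have hf : ∀ x, u x ≠ x := fun x => Perm.mem_support.1 (hs ▸ Finset.mem_univ x)
  refine enum_perm u h2 hf ?_
  rintro ⟨h0, h1, h3⟩
  have hlt : ∀ x : Fin 6, x < 3 → u x < 3 := by
    intro x hx
    have : x = 0 ∨ x = 1 ∨ x = 2 := by revert x; decide
    rcases this with rfl | rfl | rfl <;> assumption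
  obtain ⟨g, hg, hg0⟩ := htr
  have := (stab u (fun x => ⟨hlt x, fun h => by have := hlt _ h; rwa [h2] at this⟩) g hg 0).1
    (by decide)
  rw [hg0] at this
  exact absurd this (by decide)

theorem conj_trans (a b ρ : Perm (Fin 6))
    (h : ∀ x y : Fin 6, ∃ g ∈ Subgroup.closure {a, b}, g x = y) (x y : Fin 6) :
    ∃ g ∈ Subgroup.closure {ρ * a * ρ⁻¹, ρ * b * ρ⁻¹}, g x = y := by
  obtain ⟨g, hg, hxy⟩ := h (ρ⁻¹ x) (ρ⁻¹ y)
  refine ⟨ρ * g * ρ⁻¹, ?_, by rw [Perm.mul_apply, Perm.mul_apply, hxy]; simp⟩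
  have : MulAut.conj ρ g ∈ (Subgroup.closure {a, b}).map (MulAut.conj ρ).toMonoidHom :=
    ⟨g, hg, rfl⟩
  rw [MonoidHom.map_closure, Set.image_pair] at this
  exact this

theorem surj (p : Diag6) : ∃ m, diagIso p (rep m) := by
  obtain ⟨⟨a, b⟩, ha, hb, htr⟩ := p
  obtain ⟨ρ, hρ⟩ := isConj_iff.1 (Perm.isConj_iff_cycleType_eq.2 (ha.trans s_type.symm))
  simp only at ha hb htr hρ
  have h := conj_trans a b ρ htr 0 3
  rw [hρ] at h
  obtain ⟨m, i, j, k, hz⟩ := normal (ρ * b * ρ⁻¹) (by rw [Perm.cycleType_conj, hb]) h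
  refine ⟨m, z i j k * ρ, ?_, ?_⟩
  · change z i j k * ρ * a * (z i j k * ρ)⁻¹ = s
    have : z i j k * ρ * a * (z i j k * ρ)⁻¹ = z i j k * (ρ * a * ρ⁻¹) * (z i j k)⁻¹ := by group
    rw [this, hρ, z_comm, mul_inv_cancel_right]
  · change z i j k * ρ * b * (z i j k * ρ)⁻¹ = t m
    rw [← hz]; group

theorem inv_aux (a b a' b' ρ : Perm (Fin 6)) (h1 : ρ * a * ρ⁻¹ = a') (h2 : ρ * b * ρ⁻¹ = b') :
    (b * a * b * a⁻¹ = 1 ↔ b' * a' * b' * a'⁻¹ = 1) ∧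
    (b * a * b * a = 1 ↔ b' * a' * b' * a' = 1) := by
  have e1 : b' * a' * b' * a'⁻¹ = ρ * (b * a * b * a⁻¹) * ρ⁻¹ := by rw [← h1, ← h2]; group
  have e2 : b' * a' * b' * a' = ρ * (b * a * b * a) * ρ⁻¹ := by rw [← h1, ← h2]; group
  rw [e1, e2, conj_eq_one_iff, conj_eq_one_iff]
  exact ⟨Iff.rfl, Iff.rfl⟩

theorem t_sep : ∀ i j, ((t i * s * t i * s⁻¹ = 1 ↔ t j * s * t j * s⁻¹ = 1) ∧
    (t i * s * t i * s = 1 ↔ t j * s * t j * s = 1)) → i = j := by decide +kernel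

end Diag6Aux

/-- There are exactly 3 isomorphism classes of unrooted triangular maps with two
faces (6 arcs): one torus and two spheres. -/
theorem stmt_14 : Nat.card (Quotient diagIso) = 3 := by
  have hb : Function.Bijective (fun i : Fin 3 => Quotient.mk diagIso (Diag6Aux.rep i)) := by
    constructor
    · intro i j h
      obtain ⟨ρ, h1, h2⟩ := Quotient.exact h
      exact Diag6Aux.t_sep i j (Diag6Aux.inv_aux _ _ _ _ ρ h1 h2)
    · intro q
      induction q using Quotient.inductionOn with
      | h p =>
        obtain ⟨m, hm⟩ := Diag6Aux.surj p
        exact ⟨m, (Quotient.sound hm).symm⟩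
  rw [← Nat.card_eq_of_bijective _ hb, Nat.card_fin]
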